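/- Let E be a real inner product space and let G_b, G_d ∈ E with G_d ≠ 0, λ ∈ ℝ, and suppose ⟨G_d, G_b⟩ < 0. Define G_LCGC = G_b + λ · (⟨G_d, G_b⟩ / ‖G_d‖²) · G_d. Then ‖G_LCGC‖² = ‖G_b‖² + λ(λ + 2) · ⟨G_d, G_b⟩² / ‖G_d‖². In particular, for λ ≥ 0 one has ‖G_LCGC‖ ≥ ‖G_b‖, with equality if and only if λ = 0 (given ⟨G_d, G_b⟩ < 0). -/

import Mathlib

open scoped RealInnerProductSpace

/-- In the conflicting case `⟪G_d, G_b⟫ < 0`, the LCGC direction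
`G_LCGC = G_b + λ • ((⟪G_d, G_b⟫ / ‖G_d‖²) • G_d)` satisfies
`‖G_LCGC‖² = ‖G_b‖² + λ(λ+2) * ⟪G_d, G_b⟫² / ‖G_d‖²`; in particular, for
`λ ≥ 0`, `‖G_LCGC‖ ≥ ‖G_b‖` with equality iff `λ = 0`. -/
theorem lcgc_norm_sq {E : Type*} [NormedAddCommGroup E]
    [InnerProductSpace ℝ E] (Gb Gd : E) (hGd : Gd ≠ 0) (lam : ℝ)
    (hconf : ⟪Gd, Gb⟫ < 0)
    (GLCGC : E)
    (hdef : GLCGC = Gb + lam • ((⟪Gd, Gb⟫ / ‖Gd‖ ^ 2) • Gd)) :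
    ‖GLCGC‖ ^ 2 = ‖Gb‖ ^ 2 + lam * (lam + 2) * ⟪Gd, Gb⟫ ^ 2 / ‖Gd‖ ^ 2 ∧
      (0 ≤ lam → ‖Gb‖ ≤ ‖GLCGC‖ ∧ (‖GLCGC‖ = ‖Gb‖ ↔ lam = 0)) := by
  have hn : 0 < ‖Gd‖ := norm_pos_iff.mpr hGd
  have key : ‖GLCGC‖ ^ 2 =
      ‖Gb‖ ^ 2 + lam * (lam + 2) * ⟪Gd, Gb⟫ ^ 2 / ‖Gd‖ ^ 2 := by
    rw [hdef, smul_smul, norm_add_sq_real, inner_smul_right, norm_smul, mul_pow,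
      Real.norm_eq_abs, sq_abs, real_inner_comm Gd Gb]
    field_simp
    ring
  refine ⟨key, fun hl => ?_⟩
  have hc : 0 < ⟪Gd, Gb⟫ ^ 2 / ‖Gd‖ ^ 2 :=
    div_pos (sq_pos_of_neg hconf) (by positivity)
  rw [mul_div_assoc] at key
  refine ⟨?_, ?_, ?_⟩
  · have : 0 ≤ lam * (lam + 2) * (⟪Gd, Gb⟫ ^ 2 / ‖Gd‖ ^ 2) := by positivity
    exact (sq_le_sq₀ (norm_nonneg _) (norm_nonneg _)).mp (by linarith)
  · intro h
    rw [h] at key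
    have h0 : lam * (lam + 2) * (⟪Gd, Gb⟫ ^ 2 / ‖Gd‖ ^ 2) = 0 := by linarith
    rcases mul_eq_zero.mp h0 with h1 | h1
    · rcases mul_eq_zero.mp h1 with h2 | h2
      · exact h2
      · linarith
    · exact absurd h1 hc.ne'
  · intro h
    rw [hdef, h, zero_smul, add_zero]
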